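/- Let x_0 ∈ ℕ^d and let Γ′ be a finitely generated subsemigroup of (ℕ^d, +). Then the power series f = Σ_{x ∈ Γ′·x_0} t^{n(x)} q^{W(x)} ∈ ℤ[[t,q]] is rational: there exist polynomials P, Q ∈ ℤ[t,q] with Q(0,0) = 1 such that Q·f = P in ℤ[[t,q]]. -/

import Mathlib

namespace Spiral

/-- The size `n(x) = n₁ + ⋯ + n_d` of a configuration `x ∈ ℕ^d`. -/
def size {d : ℕ} (x : Fin d → ℕ) : ℕ := ∑ i, x i

/-- The weight `W(x) = Σ_{i<j} (max(0, x_j − x_i) + max(0, x_i − x_j − 1))`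
(truncated ℕ-subtraction realizes the `max(0,·)`). -/
def weight {d : ℕ} (x : Fin d → ℕ) : ℕ :=
  ∑ i : Fin d, ∑ j : Fin d, if i < j then (x j - x i) + (x i - x j - 1) else 0

/-- The configuration `x` as a set of points of `[d] × ℕ`: the point `(i, n)` (seat `i`
0-indexed, level `n`) is encoded as the natural number `n*d + i`. The usual order on the
encodings is exactly the height order `≺` (height `h(i,n) = n + i/d`), and the spiral
shift `δ + s/d` is encoded as `+ s`. -/
def pts (d : ℕ) (x : Fin d → ℕ) : Finset ℕ :=
  Finset.image (fun i : Fin d => x i * d + i.val) Finset.univ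

/-- The points of `x` listed in increasing height order: `δ¹(x), …, δ^d(x)`. -/
def sortedPts (d : ℕ) (x : Fin d → ℕ) : List ℕ :=
  (pts d x).sort (· ≤ ·)

/-- The lowest point strictly above `p` (along the spiral) whose seat lies in `S`. -/
noncomputable def nextPt (d : ℕ) (S : Finset ℕ) (p : ℕ) : ℕ :=
  sInf {q : ℕ | p < q ∧ q % d ∈ S}

/-- The spiral shifting operator `g_j` (for `1 ≤ j ≤ d`): it fixes the lowest `j - 1`
points `δ¹(x), …, δ^{j-1}(x)` and moves each remaining point `δ^k(x)` (`k ≥ j`) to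
`δ^k(x) + s_k/d`, where `s_k` is the minimal positive integer such that the seat of
`δ^k(x) + s_k/d` lies in `{i(δ^j(x)), …, i(δ^d(x))}`. The resulting configuration is read
off from the new point set (which has exactly one point per seat). -/
noncomputable def gOp (d : ℕ) (j : ℕ) (x : Fin d → ℕ) : Fin d → ℕ := fun i =>
  let L := sortedPts d x
  let low := L.take (j - 1)
  let high := L.drop (j - 1)
  let S : Finset ℕ := high.toFinset.image (· % d)
  let Q : Finset ℕ := low.toFinset ∪ (high.map (nextPt d S)).toFinset
  ∑ q ∈ Q.filter (fun q => q % d = i.val), q / d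

/-- `g^a := g₁^{a₁} ∘ ⋯ ∘ g_d^{a_d}` (here `a i` is the exponent of `g_{i+1}`). -/
noncomputable def gIter (d : ℕ) (a : Fin d → ℕ) (x : Fin d → ℕ) : Fin d → ℕ :=
  (List.finRange d).foldr (fun j y => (gOp d (j.val + 1))^[a j] y) x

end Spiral

namespace Spiral

/-- The generating series `Σ_{x ∈ S} t^{n(x)} q^{W(x)} ∈ ℤ[[t,q]]` of a set `S ⊆ ℕ^d` of
configurations, defined coefficientwise (each coefficient is a finite count, since only
finitely many `x ∈ ℕ^d` have a given size). Here `t = X 0`, `q = X 1`. -/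
noncomputable def orbitSeries (d : ℕ) (S : Set (Fin d → ℕ)) : MvPowerSeries (Fin 2) ℤ :=
  fun e => (Nat.card {x : Fin d → ℕ // x ∈ S ∧ size x = e 0 ∧ weight x = e 1} : ℤ)

end Spiral

namespace Spiral

section comb
variable {d : ℕ}

lemma nextPt_spec (hd : 1 ≤ d) {S : Finset ℕ} {p : ℕ} (hp : p % d ∈ S) :
    p < nextPt d S p ∧ nextPt d S p % d ∈ S := by
  have : ({q : ℕ | p < q ∧ q % d ∈ S}).Nonempty := ⟨p + d, by
    simp only [Set.mem_ofPred_eq, Nat.add_mod_right]; exact ⟨by omega, hp⟩⟩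
  exact Nat.sInf_mem this

lemma nextPt_le {S : Finset ℕ} {p q : ℕ} (h : p < q) (hq : q % d ∈ S) :
    nextPt d S p ≤ q := Nat.sInf_le ⟨h, hq⟩

lemma nextPt_lt (hd : 1 ≤ d) {S : Finset ℕ} {p q : ℕ} (h : p < q) (hq : q % d ∈ S) :
    nextPt d S p < nextPt d S q :=
  lt_of_le_of_lt (nextPt_le h hq) (nextPt_spec hd hq).1

lemma sub_mul_mod {q k : ℕ} (h : k * d ≤ q) : (q - k * d) % d = q % d := by
  conv_rhs => rw [← Nat.sub_add_cancel h]
  simp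

lemma nextPt_mod_inj (hd : 1 ≤ d) {S : Finset ℕ} {p q : ℕ} (hp : p % d ∈ S) (hq : q % d ∈ S)
    (h : nextPt d S p % d = nextPt d S q % d) : p % d = q % d := by
  wlog hle : nextPt d S q ≤ nextPt d S p generalizing p q
  · exact (this hq hp h.symm (by omega)).symm
  obtain ⟨k, hk⟩ : ∃ k, nextPt d S p = nextPt d S q + k * d := by
    have := (Nat.modEq_iff_dvd' hle).1 h.symm
    obtain ⟨k, hk⟩ := this
    exact ⟨k, by rw [mul_comm k d]; omega⟩
  have hp1 := nextPt_spec hd hp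
  have hq1 := nextPt_spec hd hq
  rcases lt_trichotomy p (q + k * d) with hlt | heq | hgt
  · have := nextPt_le (d := d) (S := S) hlt (by simpa using hq)
    omega
  · rw [heq]; simp
  · have h2 : k * d ≤ p := by omega
    have := nextPt_le (d := d) (S := S) (p := q) (q := p - k * d) (by omega)
      (by rw [sub_mul_mod h2]; exact hp)
    omega

lemma next_div (hd : 1 ≤ d) {S : Finset ℕ} {p q : ℕ} (hp : p % d ∈ S) (hq : q % d ∈ S)
    (hne : p = q ∨ p % d ≠ q % d) : (nextPt d S q - nextPt d S p) / d = (q - p) / d := by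
  have hp1 := nextPt_spec hd hp
  have hq1 := nextPt_spec hd hq
  rcases lt_trichotomy p q with hlt | heq | hgt
  · have hne' : p % d ≠ q % d := by rcases hne with h | h; omega; exact h
    set k := (q - p) / d with hk
    have h1 : k * d ≤ q - p := Nat.div_mul_le_self _ _
    have h2 : q - p < (k + 1) * d := by
      have := Nat.lt_div_mul_add (a := q - p) (b := d) (by omega)
      rw [add_mul, one_mul]; exact this
    have h3 : q - p ≠ k * d := by
      intro h
      apply hne'
      have : q = p + k * d := by omega
      rw [this]; simp
    have h4 : nextPt d S p ≤ q - k * d :=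
      nextPt_le (by omega) (by rw [sub_mul_mod (by omega)]; exact hq)
    have h5 : nextPt d S q ≤ p + (k + 1) * d :=
      nextPt_le (by omega) (by simpa using hp)
    apply Nat.div_eq_of_lt_le
    · omega
    · omega
  · subst heq; simp
  · have := nextPt_lt hd (S := S) hgt hp
    rw [Nat.sub_eq_zero_of_le this.le, Nat.sub_eq_zero_of_le hgt.le]

lemma sum_next_zero (hd : 1 ≤ d) (H : Finset ℕ) (hinj : Set.InjOn (· % d) (H : Set ℕ))
    (hne : H.Nonempty) :
    ∑ q ∈ H, nextPt d (H.image (· % d)) q / d = ∑ q ∈ H, q / d + 1 := by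
  set S := H.image (· % d) with hS
  have hmem : ∀ q ∈ H, q % d ∈ S := fun q hq => Finset.mem_image_of_mem _ hq
  obtain ⟨m, hm, hmax⟩ := H.exists_max_image (· % d) hne
  rw [← Finset.add_sum_erase _ _ hm, ← Finset.add_sum_erase H (fun q => q / d) hm]
  have h1 : nextPt d S m / d = m / d + 1 := by
    have hs := nextPt_spec hd (hmem m hm)
    have hle : nextPt d S m ≤ m + d := nextPt_le (by omega) (by simpa using hmem m hm)
    have h2 : nextPt d S m / d ≤ m / d + 1 := by
      calc _ ≤ (m + d) / d := Nat.div_le_div_right hle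
        _ = _ := by rw [Nat.add_div_right _ (by omega)]
    have h3 : m / d ≤ nextPt d S m / d := Nat.div_le_div_right hs.1.le
    by_contra hc
    have h4 : nextPt d S m / d = m / d := by omega
    obtain ⟨q, hq, hqe⟩ := Finset.mem_image.1 hs.2
    have := hmax q hq
    have e1 := Nat.div_add_mod (nextPt d S m) d
    have e2 := Nat.div_add_mod m d
    rw [h4] at e1
    omega
  have h2 : ∑ q ∈ H.erase m, nextPt d S q / d = ∑ q ∈ H.erase m, q / d := by
    apply Finset.sum_congr rfl
    intro q hq
    obtain ⟨hqm, hqH⟩ := Finset.mem_erase.1 hq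
    have hs := nextPt_spec hd (hmem q hqH)
    have hlt : q % d < m % d := lt_of_le_of_ne (hmax q hqH) (fun h => hqm (hinj hqH hm h))
    have e2 := Nat.div_add_mod q d
    have hmd := Nat.mod_lt m (show d > 0 by omega)
    have hle : nextPt d S q ≤ d * (q / d) + m % d := nextPt_le (by omega) (by
      simpa using hmem m hm)
    apply le_antisymm
    · calc _ ≤ (d * (q / d) + m % d) / d := Nat.div_le_div_right hle
        _ = _ := by rw [Nat.mul_add_div (by omega), Nat.div_eq_of_lt hmd, add_zero]
    · exact Nat.div_le_div_right hs.1.le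
  rw [h1, h2]; omega

lemma sum_next (hd : 1 ≤ d) (H : Finset ℕ) (hinj : Set.InjOn (· % d) (H : Set ℕ))
    (hne : H.Nonempty) (r : ℕ) :
    ∑ q ∈ H, (nextPt d (H.image (· % d)) q + r) / d = ∑ q ∈ H, (q + r) / d + 1 := by
  have h0 := sum_next_zero hd H hinj hne
  set S := H.image (· % d) with hS
  have hmem : ∀ q ∈ H, q % d ∈ S := fun q hq => Finset.mem_image_of_mem _ hq
  have hinj' : Set.InjOn (fun q => nextPt d S q % d) (H : Set ℕ) := by
    intro p hp q hq h
    exact hinj hp hq (nextPt_mod_inj hd (hmem p hp) (hmem q hq) h)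
  have himg : H.image (fun q => nextPt d S q % d) = S := by
    apply Finset.eq_of_subset_of_card_le
    · intro s hs
      obtain ⟨q, hq, rfl⟩ := Finset.mem_image.1 hs
      exact (nextPt_spec hd (hmem q hq)).2
    · rw [Finset.card_image_of_injOn hinj', hS]; exact Finset.card_image_le
  have hres : ∀ r, ∑ q ∈ H, (nextPt d S q + r) % d = ∑ q ∈ H, (q + r) % d := by
    intro r
    have a1 : ∑ s ∈ S, (s + r) % d = ∑ q ∈ H, (nextPt d S q + r) % d := by
      conv_lhs => rw [← himg]
      rw [Finset.sum_image hinj']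
      simp
    have a2 : ∑ s ∈ S, (s + r) % d = ∑ q ∈ H, (q + r) % d := by
      rw [hS, Finset.sum_image hinj]
      simp
    rw [← a1, a2]
  have key : ∀ (f : ℕ → ℕ), ∑ q ∈ H, f q = d * ∑ q ∈ H, f q / d + ∑ q ∈ H, f q % d := by
    intro f
    rw [Finset.mul_sum, ← Finset.sum_add_distrib]
    exact Finset.sum_congr rfl fun q _ => (Nat.div_add_mod _ _).symm
  have k1 := key (fun q => nextPt d S q)
  have k2 := key (fun q => q)
  have k3 := key (fun q => nextPt d S q + r)
  have k4 := key (fun q => q + r)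
  have r0 := hres 0
  simp only [add_zero] at r0
  rw [hres r, Finset.sum_add_distrib] at k3
  rw [Finset.sum_add_distrib] at k4
  rw [r0, h0] at k1
  have : d * ∑ q ∈ H, (nextPt d S q + r) / d = d * (∑ q ∈ H, (q + r) / d + 1) := by
    rw [mul_add] at k1 ⊢
    omega
  exact Nat.eq_of_mul_eq_mul_left (by omega) this

lemma sum_next_sub (hd : 1 ≤ d) (H : Finset ℕ) (hinj : Set.InjOn (· % d) (H : Set ℕ))
    (hne : H.Nonempty) (a : ℕ) (ha : ∀ q ∈ H, a < q) :
    ∑ q ∈ H, (nextPt d (H.image (· % d)) q - a) / d = ∑ q ∈ H, (q - a) / d + 1 := by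
  have h := sum_next hd H hinj hne (a * (d - 1))
  have hmem : ∀ q ∈ H, q % d ∈ H.image (· % d) := fun q hq => Finset.mem_image_of_mem _ hq
  have key : ∀ q, a < q → (q + a * (d - 1)) / d = (q - a) / d + a := by
    intro q hq
    have : q + a * (d - 1) = (q - a) + a * d := by
      obtain ⟨e, rfl⟩ : ∃ e, d = e + 1 := ⟨d - 1, by omega⟩
      simp only [Nat.add_sub_cancel, mul_add]; omega
    rw [this, Nat.add_mul_div_right _ _ (by omega)]
  rw [Finset.sum_congr rfl (fun q hq => key _ ((ha q hq).trans (nextPt_spec hd (hmem q hq)).1)),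
    Finset.sum_congr rfl (fun q hq => key q (ha q hq)), Finset.sum_add_distrib,
    Finset.sum_add_distrib] at h
  omega

/-! ### Point sets -/

lemma enc_mod (x : Fin d → ℕ) (i : Fin d) : (x i * d + i.val) % d = i.val := by
  rw [Nat.mul_add_mod_self_right, Nat.mod_eq_of_lt i.2]

lemma enc_div (x : Fin d → ℕ) (i : Fin d) : (x i * d + i.val) / d = x i := by
  have : 0 < d := i.pos
  rw [mul_comm, Nat.mul_add_div this, Nat.div_eq_of_lt i.2, add_zero]

lemma enc_inj (x : Fin d → ℕ) : Function.Injective (fun i : Fin d => x i * d + i.val) := by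
  intro i j h
  have := congrArg (· % d) h
  simp only [enc_mod] at this
  exact Fin.ext this

lemma pts_card (x : Fin d → ℕ) : (pts d x).card = d := by
  rw [pts, Finset.card_image_of_injective _ (enc_inj x)]; simp

lemma pts_modInj (x : Fin d → ℕ) : Set.InjOn (· % d) (pts d x : Set ℕ) := by
  intro p hp q hq h
  simp only [pts, Finset.coe_image, Finset.coe_univ, Set.image_univ, Set.mem_range] at hp hq
  obtain ⟨i, rfl⟩ := hp
  obtain ⟨j, rfl⟩ := hq
  simp only [enc_mod] at h
  rw [Fin.ext h]

lemma pts_inj {x y : Fin d → ℕ} (h : pts d x = pts d y) : x = y := by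
  funext i
  have : x i * d + i.val ∈ pts d y := by
    rw [← h]; exact Finset.mem_image_of_mem _ (Finset.mem_univ i)
  obtain ⟨j, -, hj⟩ := Finset.mem_image.1 this
  have h1 := congrArg (· % d) hj
  simp only [enc_mod] at h1
  obtain rfl := Fin.ext h1
  have h2 := congrArg (· / d) hj
  simp only [enc_div] at h2
  exact h2.symm

lemma pts_of (hd : 1 ≤ d) (Q : Finset ℕ) (hinj : Set.InjOn (· % d) (Q : Set ℕ)) (hc : Q.card = d) :
    pts d (fun i => ∑ q ∈ Q.filter (fun q => q % d = i.val), q / d) = Q := by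
  symm
  apply Finset.eq_of_subset_of_card_le
  · intro q hq
    refine Finset.mem_image.2 ⟨⟨q % d, Nat.mod_lt _ (by omega)⟩, Finset.mem_univ _, ?_⟩
    have : Q.filter (fun q' => q' % d = q % d) = {q} := by
      ext q'
      simp only [Finset.mem_filter, Finset.mem_singleton]
      constructor
      · rintro ⟨h1, h2⟩; exact hinj h1 hq h2
      · rintro rfl; exact ⟨hq, rfl⟩
    simp only [this, Finset.sum_singleton]
    exact Nat.div_add_mod' q d
  · rw [pts_card, hc]

lemma size_eq (x : Fin d → ℕ) : size x = ∑ p ∈ pts d x, p / d := by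
  rw [pts, Finset.sum_image (fun i _ j _ h => enc_inj x h)]
  simp only [enc_div]; rfl

lemma pair_weight (x : Fin d → ℕ) {i j : Fin d} (h : i < j) :
    (x j - x i) + (x i - x j - 1) =
      ((x j * d + j.val) - (x i * d + i.val)) / d + ((x i * d + i.val) - (x j * d + j.val)) / d := by
  have hij : i.val < j.val := h
  have hj := j.2
  have hd : 0 < d := by omega
  rcases le_or_gt (x i) (x j) with hle | hlt
  · obtain ⟨k, hk⟩ := Nat.exists_eq_add_of_le hle
    have e1 : (x j * d + j.val) - (x i * d + i.val) = d * k + (j.val - i.val) := by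
      rw [hk, add_mul, mul_comm k d]; omega
    have e2 : (x i * d + i.val) - (x j * d + j.val) = 0 := by
      rw [hk, add_mul]; omega
    rw [e1, e2, Nat.mul_add_div hd, Nat.div_eq_of_lt (by omega)]
    simp; omega
  · obtain ⟨k, hk⟩ := Nat.exists_eq_add_of_lt hlt
    have e1 : (x i * d + i.val) - (x j * d + j.val) = d * k + (d + i.val - j.val) := by
      rw [hk, add_mul, add_mul, mul_comm k d, one_mul]; omega
    have e2 : (x j * d + j.val) - (x i * d + i.val) = 0 := by
      rw [hk, add_mul, add_mul, one_mul]; omega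
    rw [e1, e2, Nat.mul_add_div hd,
      Nat.div_eq_of_lt (show d + i.val - j.val < d by omega), Nat.zero_div]
    omega

lemma weight_eq (x : Fin d → ℕ) :
    weight x = ∑ p ∈ pts d x, ∑ q ∈ pts d x, (q - p) / d := by
  have hs : ∀ f : ℕ → ℕ, ∑ p ∈ pts d x, f p = ∑ i : Fin d, f (x i * d + i.val) := by
    intro f
    rw [pts, Finset.sum_image (fun i _ j _ h => enc_inj x h)]
  rw [hs]
  simp only [hs]
  set a : Fin d → Fin d → ℕ := fun i j => ((x j * d + j.val) - (x i * d + i.val)) / d with ha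
  change weight x = ∑ i, ∑ j, a i j
  have h1 : ∀ i j, a i j = (if i < j then a i j else 0) + (if j < i then a i j else 0) := by
    intro i j
    rcases lt_trichotomy i j with h | h | h
    · simp [h, h.not_gt]
    · subst h; simp [ha]
    · simp [h, h.not_gt]
  have h2 : ∑ i, ∑ j, a i j = ∑ i, ∑ j, (if i < j then a i j + a j i else 0) := by
    calc ∑ i, ∑ j, a i j
        = ∑ i, ∑ j, (if i < j then a i j else 0) + ∑ i, ∑ j, (if j < i then a i j else 0) := by
          rw [← Finset.sum_add_distrib]
          refine Finset.sum_congr rfl fun i _ => ?_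
          rw [← Finset.sum_add_distrib]
          exact Finset.sum_congr rfl fun j _ => h1 i j
      _ = ∑ i, ∑ j, (if i < j then a i j else 0) + ∑ i, ∑ j, (if i < j then a j i else 0) := by
          congr 1
          rw [Finset.sum_comm]
      _ = _ := by
          rw [← Finset.sum_add_distrib]
          refine Finset.sum_congr rfl fun i _ => ?_
          rw [← Finset.sum_add_distrib]
          refine Finset.sum_congr rfl fun j _ => ?_
          split_ifs <;> simp
  rw [h2, weight]
  refine Finset.sum_congr rfl fun i _ => Finset.sum_congr rfl fun j _ => ?_
  split_ifs with h
  · exact pair_weight x h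
  · rfl

/-! ### The list description of `gOp` -/

lemma sorted_lt (x : Fin d → ℕ) : (sortedPts d x).Pairwise (· < ·) :=
  (Finset.sortedLT_sort _).pairwise

lemma sorted_length (x : Fin d → ℕ) : (sortedPts d x).length = d := by
  rw [sortedPts, Finset.length_sort, pts_card]

lemma sorted_toFinset (x : Fin d → ℕ) : (sortedPts d x).toFinset = pts d x := by
  rw [sortedPts, Finset.sort_toFinset]

/-- seats of the high points -/
def seats (d j : ℕ) (x : Fin d → ℕ) : Finset ℕ :=
  ((sortedPts d x).drop j).toFinset.image (· % d)

lemma seats_mem {j : ℕ} {x : Fin d → ℕ} {q : ℕ} (h : q ∈ (sortedPts d x).drop j) :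
    q % d ∈ seats d j x := Finset.mem_image_of_mem _ (List.mem_toFinset.2 h)

lemma take_lt_drop {j : ℕ} {x : Fin d → ℕ} {a h : ℕ} (ha : a ∈ (sortedPts d x).take j)
    (hh : h ∈ (sortedPts d x).drop j) : a < h := by
  have := sorted_lt x
  rw [← List.take_append_drop j (sortedPts d x), List.pairwise_append] at this
  exact this.2.2 a ha h hh

lemma mem_pts_of_take {j : ℕ} {x : Fin d → ℕ} {a : ℕ} (ha : a ∈ (sortedPts d x).take j) :
    a ∈ pts d x := by
  rw [← sorted_toFinset, List.mem_toFinset]; exact List.mem_of_mem_take ha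

lemma mem_pts_of_drop {j : ℕ} {x : Fin d → ℕ} {a : ℕ} (ha : a ∈ (sortedPts d x).drop j) :
    a ∈ pts d x := by
  rw [← sorted_toFinset, List.mem_toFinset]; exact List.mem_of_mem_drop ha

lemma take_not_seat {j : ℕ} {x : Fin d → ℕ} {a : ℕ} (ha : a ∈ (sortedPts d x).take j) :
    a % d ∉ seats d j x := by
  intro h
  obtain ⟨q, hq, hqe⟩ := Finset.mem_image.1 h
  rw [List.mem_toFinset] at hq
  have := pts_modInj x (mem_pts_of_drop hq) (mem_pts_of_take ha) hqe
  have := take_lt_drop ha hq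
  omega

/-- sorted list of the points of `gOp` -/
noncomputable def newL (d j : ℕ) (x : Fin d → ℕ) : List ℕ :=
  (sortedPts d x).take j ++ ((sortedPts d x).drop j).map (nextPt d (seats d j x))

lemma newL_sorted (hd : 1 ≤ d) (j : ℕ) (x : Fin d → ℕ) : (newL d j x).Pairwise (· < ·) := by
  rw [newL, List.pairwise_append]
  refine ⟨(sorted_lt x).sublist (List.take_sublist _ _), ?_, ?_⟩
  · rw [List.pairwise_map]
    refine ((sorted_lt x).sublist (List.drop_sublist j _)).imp_of_mem ?_
    intro a b _ hb hab
    exact nextPt_lt hd hab (seats_mem hb)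
  · intro a ha b hb
    obtain ⟨h, hh, rfl⟩ := List.mem_map.1 hb
    exact (take_lt_drop ha hh).trans (nextPt_spec hd (seats_mem hh)).1

lemma newL_modInj (hd : 1 ≤ d) (j : ℕ) (x : Fin d → ℕ) :
    Set.InjOn (· % d) ((newL d j x).toFinset : Set ℕ) := by
  intro p hp q hq h
  simp only [newL, List.coe_toFinset, List.mem_append, Set.mem_ofPred_eq, List.mem_map] at hp hq
  simp only at h
  rcases hp with hp | ⟨p', hp, rfl⟩ <;> rcases hq with hq | ⟨q', hq, rfl⟩
  · exact pts_modInj x (mem_pts_of_take hp) (mem_pts_of_take hq) h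
  · exact absurd (h ▸ (nextPt_spec hd (seats_mem hq)).2) (take_not_seat hp)
  · exact absurd (h ▸ (nextPt_spec hd (seats_mem hp)).2) (take_not_seat hq)
  · rw [pts_modInj x (mem_pts_of_drop hp) (mem_pts_of_drop hq)
      (nextPt_mod_inj hd (seats_mem hp) (seats_mem hq) h)]

lemma pts_gOp (hd : 1 ≤ d) (j : ℕ) (x : Fin d → ℕ) :
    pts d (gOp d (j + 1) x) = (newL d j x).toFinset := by
  have hc : (newL d j x).toFinset.card = d := by
    rw [List.toFinset_card_of_nodup ((newL_sorted hd j x).imp (fun h => h.ne))]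
    rw [newL, List.length_append, List.length_map, ← List.length_append,
      List.take_append_drop, sorted_length]
  have := pts_of hd _ (newL_modInj hd j x) hc
  rw [← this]
  congr 1
  funext i
  simp only [gOp, newL, Nat.add_sub_cancel, List.toFinset_append]
  rfl

lemma sorted_gOp (hd : 1 ≤ d) (j : ℕ) (x : Fin d → ℕ) :
    sortedPts d (gOp d (j + 1) x) = newL d j x := by
  rw [sortedPts, pts_gOp hd]
  exact (List.toFinset_sort (· ≤ ·) ((newL_sorted hd j x).imp (fun h => h.ne))).2
    ((newL_sorted hd j x).imp (fun h => h.le))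

lemma pts_split (j : ℕ) (x : Fin d → ℕ) :
    pts d x = ((sortedPts d x).take j).toFinset ∪ ((sortedPts d x).drop j).toFinset := by
  rw [← List.toFinset_append, List.take_append_drop, sorted_toFinset]

lemma pts_gOp' (hd : 1 ≤ d) (j : ℕ) (x : Fin d → ℕ) :
    pts d (gOp d (j + 1) x) = ((sortedPts d x).take j).toFinset ∪
      ((sortedPts d x).drop j).toFinset.image (nextPt d (seats d j x)) := by
  rw [pts_gOp hd, newL, List.toFinset_append]
  congr 1
  ext q; simp only [List.mem_toFinset, List.mem_map, Finset.mem_image]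

lemma high_facts (hd : 1 ≤ d) {j : ℕ} (hj : j < d) (x : Fin d → ℕ) :
    ∃ A H : Finset ℕ, A.card = j ∧ H.Nonempty ∧ seats d j x = H.image (· % d) ∧
      Set.InjOn (· % d) (H : Set ℕ) ∧ (∀ a ∈ A, ∀ h ∈ H, a < h) ∧
      Set.InjOn (nextPt d (seats d j x)) (H : Set ℕ) ∧ (∀ h ∈ H, h < nextPt d (seats d j x) h) ∧
      pts d x = A ∪ H ∧ pts d (gOp d (j + 1) x) = A ∪ H.image (nextPt d (seats d j x)) := by
  refine ⟨((sortedPts d x).take j).toFinset, ((sortedPts d x).drop j).toFinset,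
    ?_, ?_, rfl, ?_, ?_, ?_, ?_, pts_split j x, pts_gOp' hd j x⟩
  · rw [List.toFinset_card_of_nodup, List.length_take, sorted_length]
    · omega
    · exact ((sorted_lt x).sublist (List.take_sublist _ _)).imp (fun h => h.ne)
  · rw [List.toFinset_nonempty_iff]
    intro h
    have := congrArg List.length h
    rw [List.length_drop, sorted_length] at this
    simp at this; omega
  · exact (pts_modInj x).mono (by rw [pts_split j x]; simp)
  · intro a ha h hh
    exact take_lt_drop (List.mem_toFinset.1 ha) (List.mem_toFinset.1 hh)
  · intro p hp q hq h
    simp only [List.coe_toFinset, Set.mem_ofPred_eq] at hp hq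
    rcases lt_trichotomy p q with hl | hl | hl
    · have := nextPt_lt hd hl (seats_mem hq); omega
    · exact hl
    · have := nextPt_lt hd hl (seats_mem hp); omega
  · intro h hh
    exact (nextPt_spec hd (seats_mem (List.mem_toFinset.1 hh))).1

lemma size_gOp (hd : 1 ≤ d) {j : ℕ} (hj : j < d) (x : Fin d → ℕ) :
    size (gOp d (j + 1) x) = size x + 1 := by
  obtain ⟨A, H, hA, hne, hS, hm, hlt, hi, hgt, h1, h2⟩ := high_facts hd hj x
  rw [size_eq, size_eq, h1, h2, Finset.sum_union, Finset.sum_union, Finset.sum_image hi, hS,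
    sum_next_zero hd H hm hne, add_assoc]
  · rw [Finset.disjoint_left]; intro a ha hh; exact lt_irrefl _ (hlt a ha a hh)
  · rw [Finset.disjoint_left]; intro a ha hh
    obtain ⟨h, hh', rfl⟩ := Finset.mem_image.1 hh
    have := hgt h hh'
    have := hlt _ ha h hh'
    omega

lemma weight_gOp (hd : 1 ≤ d) {j : ℕ} (hj : j < d) (x : Fin d → ℕ) :
    weight (gOp d (j + 1) x) = weight x + j := by
  obtain ⟨A, H, hA, hne, hS, hm, hlt, hi, hgt, h1, h2⟩ := high_facts hd hj x
  have hd1 : Disjoint A H := by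
    rw [Finset.disjoint_left]; intro a ha hh; exact lt_irrefl _ (hlt a ha a hh)
  have hd2 : Disjoint A (H.image (nextPt d (seats d j x))) := by
    rw [Finset.disjoint_left]; intro a ha hh
    obtain ⟨h, hh', rfl⟩ := Finset.mem_image.1 hh
    have := hgt h hh'
    have := hlt _ ha h hh'
    omega
  rw [weight_eq, weight_eq, h1, h2]
  simp only [Finset.sum_union hd1, Finset.sum_union hd2, Finset.sum_image hi,
    Finset.sum_add_distrib]
  have e1 : ∑ a ∈ A, ∑ h ∈ H, (nextPt d (seats d j x) h - a) / d
      = ∑ a ∈ A, ∑ h ∈ H, (h - a) / d + j := by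
    rw [Finset.sum_congr rfl (fun a ha => by
      rw [hS, sum_next_sub hd H hm hne a (fun q hq => hlt a ha q hq)]), Finset.sum_add_distrib]
    simp [hA]
  have e2 : ∑ h ∈ H, ∑ a ∈ A, (a - nextPt d (seats d j x) h) / d
      = ∑ h ∈ H, ∑ a ∈ A, (a - h) / d := by
    refine Finset.sum_congr rfl fun h hh => Finset.sum_congr rfl fun a ha => ?_
    have := hlt a ha h hh
    have := hgt h hh
    rw [Nat.sub_eq_zero_of_le (by omega), Nat.sub_eq_zero_of_le (by omega)]
  have e3 : ∑ p ∈ H, ∑ q ∈ H, (nextPt d (seats d j x) q - nextPt d (seats d j x) p) / d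
      = ∑ p ∈ H, ∑ q ∈ H, (q - p) / d := by
    refine Finset.sum_congr rfl fun p hp => Finset.sum_congr rfl fun q hq => ?_
    apply next_div hd
    · rw [hS]; exact Finset.mem_image_of_mem _ hp
    · rw [hS]; exact Finset.mem_image_of_mem _ hq
    · by_cases h : p = q
      · exact Or.inl h
      · exact Or.inr fun h' => h (hm hp hq h')
  rw [e1, e2, e3]; omega

/-! ### Injectivity -/

lemma take_newL (k j : ℕ) (hk : k ≤ j) (hj : j ≤ d) (x : Fin d → ℕ) :
    (newL d j x).take k = (sortedPts d x).take k := by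
  rw [newL, List.take_append_of_le_length (by rw [List.length_take, sorted_length]; omega),
    List.take_take, min_eq_left hk]

lemma mem_seats_iff (hd : 1 ≤ d) (j : ℕ) (x : Fin d → ℕ) (s : ℕ) :
    s ∈ seats d j x ↔ s < d ∧ ∀ a ∈ (sortedPts d x).take j, a % d ≠ s := by
  constructor
  · intro hs
    refine ⟨?_, ?_⟩
    · obtain ⟨q, -, rfl⟩ := Finset.mem_image.1 hs
      exact Nat.mod_lt _ (by omega)
    · rintro a ha rfl
      exact take_not_seat ha hs
  · rintro ⟨hs, ha⟩
    have h1 : x ⟨s, hs⟩ * d + s ∈ pts d x :=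
      Finset.mem_image_of_mem (fun i : Fin d => x i * d + i.val) (Finset.mem_univ (⟨s, hs⟩ : Fin d))
    have h2 : (x ⟨s, hs⟩ * d + s) % d = s := enc_mod x ⟨s, hs⟩
    rw [pts_split j x, Finset.mem_union, List.mem_toFinset, List.mem_toFinset] at h1
    rcases h1 with h1 | h1
    · exact absurd h2 (ha _ h1)
    · rw [← h2]; exact seats_mem h1

lemma map_inj_on {f : ℕ → ℕ} {P : ℕ → Prop} (hf : ∀ a b, P a → P b → f a = f b → a = b) :
    ∀ {l m : List ℕ}, (∀ a ∈ l, P a) → (∀ a ∈ m, P a) → l.map f = m.map f → l = m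
  | [], [], _, _, _ => rfl
  | [], b :: m, _, _, h => by simp at h
  | a :: l, [], _, _, h => by simp at h
  | a :: l, b :: m, hl, hm, h => by
    simp only [List.map_cons, List.cons.injEq] at h
    rw [hf a b (hl a (by simp)) (hm b (by simp)) h.1,
      map_inj_on hf (fun c hc => hl c (by simp [hc])) (fun c hc => hm c (by simp [hc])) h.2]

lemma gOp_inj (hd : 1 ≤ d) {j : ℕ} (hj : j < d) : Function.Injective (gOp d (j + 1)) := by
  intro x y h
  have hL : newL d j x = newL d j y := by rw [← sorted_gOp hd, ← sorted_gOp hd, h]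
  have ht : (sortedPts d x).take j = (sortedPts d y).take j := by
    rw [← take_newL j j le_rfl hj.le, ← take_newL j j le_rfl hj.le, hL]
  have hS : seats d j x = seats d j y := by
    ext s; rw [mem_seats_iff hd, mem_seats_iff hd, ht]
  have hD : (sortedPts d x).drop j = (sortedPts d y).drop j := by
    simp only [newL, ht, List.append_cancel_left_eq] at hL
    rw [← hS] at hL
    refine map_inj_on (P := fun q => q % d ∈ seats d j x) ?_ (fun a ha => seats_mem ha)
      (fun a ha => hS ▸ seats_mem ha) hL
    intro a b ha hb hab
    rcases lt_trichotomy a b with hl | hl | hl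
    · have := nextPt_lt hd hl hb; omega
    · exact hl
    · have := nextPt_lt hd hl ha; omega
  apply pts_inj
  rw [pts_split j x, pts_split j y, ht, hD]

/-- sum of the lowest `k` points -/
def lowSum (d k : ℕ) (x : Fin d → ℕ) : ℕ := ((sortedPts d x).take k).sum

lemma lowSum_gOp_le (hd : 1 ≤ d) {k j : ℕ} (hk : k ≤ j) (hj : j < d) (x : Fin d → ℕ) :
    lowSum d k (gOp d (j + 1) x) = lowSum d k x := by
  rw [lowSum, lowSum, sorted_gOp hd, take_newL k j hk hj.le]

lemma lowSum_gOp_lt (hd : 1 ≤ d) {j : ℕ} (hj : j < d) (x : Fin d → ℕ) :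
    lowSum d (j + 1) x < lowSum d (j + 1) (gOp d (j + 1) x) := by
  have hl := sorted_length x
  have hj' : j < (sortedPts d x).length := by omega
  have hj2 : j < (newL d j x).length := by
    rw [← sorted_gOp hd, sorted_length]; exact hj
  rw [lowSum, lowSum, sorted_gOp hd, List.take_succ_eq_append_getElem hj',
    List.take_succ_eq_append_getElem hj2, take_newL j j le_rfl hj.le, List.sum_append,
    List.sum_append]
  have : (newL d j x)[j] = nextPt d (seats d j x) (sortedPts d x)[j] := by
    simp only [newL]
    rw [List.getElem_append_right (by simp)]
    simp [min_eq_left hj'.le]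
  rw [this]
  have hm : (sortedPts d x)[j] ∈ (sortedPts d x).drop j := by
    rw [List.drop_eq_getElem_cons hj']; exact List.mem_cons_self
  have := (nextPt_spec hd (seats_mem hm)).1
  simp only [List.sum_cons, List.sum_nil, add_zero]
  omega

lemma iter_lowSum_le (hd : 1 ≤ d) {k j : ℕ} (hk : k ≤ j) (hj : j < d) (n : ℕ) (x : Fin d → ℕ) :
    lowSum d k ((gOp d (j + 1))^[n] x) = lowSum d k x := by
  induction n with
  | zero => rfl
  | succ n ih => rw [Function.iterate_succ_apply', lowSum_gOp_le hd hk hj, ih]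

lemma iter_lowSum_lt (hd : 1 ≤ d) {j : ℕ} (hj : j < d) (n : ℕ) (x : Fin d → ℕ) :
    lowSum d (j + 1) x + n ≤ lowSum d (j + 1) ((gOp d (j + 1))^[n] x) := by
  induction n with
  | zero => simp
  | succ n ih =>
    rw [Function.iterate_succ_apply']
    have := lowSum_gOp_lt hd hj ((gOp d (j + 1))^[n] x)
    omega

/-- partial version of `gIter` -/
noncomputable def part (l : List (Fin d)) (a : Fin d → ℕ) (x : Fin d → ℕ) : Fin d → ℕ :=
  l.foldr (fun j y => (gOp d (j.val + 1))^[a j] y) x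

lemma part_lowSum (hd : 1 ≤ d) (a : Fin d → ℕ) (x : Fin d → ℕ) (k : ℕ) (l : List (Fin d))
    (hl : ∀ j ∈ l, k ≤ j.val) : lowSum d k (part l a x) = lowSum d k x := by
  induction l with
  | nil => rfl
  | cons j l ih =>
    simp only [part, List.foldr_cons]
    rw [iter_lowSum_le hd (hl j (by simp)) j.2]
    exact ih fun i hi => hl i (by simp [hi])

lemma iter_aux (hd : 1 ≤ d) {j : ℕ} (hj : j < d) {n m : ℕ} (hnm : n ≤ m) {y z : Fin d → ℕ}
    (hs : lowSum d (j + 1) y = lowSum d (j + 1) z)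
    (h : (gOp d (j + 1))^[n] y = (gOp d (j + 1))^[m] z) : n = m ∧ y = z := by
  obtain ⟨k, rfl⟩ := Nat.exists_eq_add_of_le hnm
  rw [Function.iterate_add_apply] at h
  have h' := (gOp_inj hd hj).iterate n h
  have := iter_lowSum_lt hd hj k z
  rw [← h'] at this
  obtain rfl : k = 0 := by omega
  exact ⟨rfl, h'⟩

lemma part_inj (hd : 1 ≤ d) (a b : Fin d → ℕ) (x : Fin d → ℕ) (l : List (Fin d))
    (hl : l.Pairwise (· < ·)) (h : part l a x = part l b x) : ∀ j ∈ l, a j = b j := by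
  induction l with
  | nil => simp
  | cons j l ih =>
    rw [List.pairwise_cons] at hl
    have hlow : ∀ c, lowSum d (j.val + 1) (part l c x) = lowSum d (j.val + 1) x :=
      fun c => part_lowSum hd c x _ l (fun i hi => hl.1 i hi)
    have h' : (gOp d (j.val + 1))^[a j] (part l a x) = (gOp d (j.val + 1))^[b j] (part l b x) := h
    have key : a j = b j ∧ part l a x = part l b x := by
      rcases le_total (a j) (b j) with hle | hle
      · exact iter_aux hd j.2 hle (by rw [hlow, hlow]) h'
      · have := iter_aux hd j.2 hle (by rw [hlow, hlow]) h'.symm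
        exact ⟨this.1.symm, this.2.symm⟩
    intro i hi
    rcases List.mem_cons.1 hi with rfl | hi
    · exact key.1
    · exact ih hl.2 key.2 i hi

lemma gIter_inj (hd : 1 ≤ d) (x : Fin d → ℕ) : Function.Injective (fun a => gIter d a x) := by
  intro a b h
  funext j
  exact part_inj hd a b x (List.finRange d) (List.pairwise_lt_finRange d) h j (List.mem_finRange j)

lemma iter_size (hd : 1 ≤ d) {j : ℕ} (hj : j < d) (n : ℕ) (x : Fin d → ℕ) :
    size ((gOp d (j + 1))^[n] x) = size x + n := by
  induction n with
  | zero => rfl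
  | succ n ih => rw [Function.iterate_succ_apply', size_gOp hd hj, ih]; omega

lemma iter_weight (hd : 1 ≤ d) {j : ℕ} (hj : j < d) (n : ℕ) (x : Fin d → ℕ) :
    weight ((gOp d (j + 1))^[n] x) = weight x + j * n := by
  induction n with
  | zero => rfl
  | succ n ih => rw [Function.iterate_succ_apply', weight_gOp hd hj, ih, mul_add]; omega

lemma part_size (hd : 1 ≤ d) (a x : Fin d → ℕ) (l : List (Fin d)) :
    size (part l a x) = size x + (l.map a).sum ∧
      weight (part l a x) = weight x + (l.map (fun j => j.val * a j)).sum := by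
  induction l with
  | nil => exact ⟨rfl, rfl⟩
  | cons j l ih =>
    have h' : part (j :: l) a x = (gOp d (j.val + 1))^[a j] (part l a x) := rfl
    rw [h', iter_size hd j.2, iter_weight hd j.2, ih.1, ih.2, List.map_cons, List.map_cons,
      List.sum_cons, List.sum_cons]
    constructor <;> omega

lemma gIter_size (hd : 1 ≤ d) (a x : Fin d → ℕ) : size (gIter d a x) = size x + ∑ j, a j := by
  have := (part_size hd a x (List.finRange d)).1
  rw [← List.ofFn_eq_map, List.sum_ofFn] at this
  exact this

lemma gIter_weight (hd : 1 ≤ d) (a x : Fin d → ℕ) :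
    weight (gIter d a x) = weight x + ∑ j : Fin d, j.val * a j := by
  have := (part_size hd a x (List.finRange d)).2
  rw [← List.ofFn_eq_map, List.sum_ofFn] at this
  exact this

end comb

end Spiral
namespace Spiral

section series
open MvPowerSeries

/-- generating series of a set with weights -/
noncomputable def gf {X : Type*} (ω : X → (Fin 2 →₀ ℕ)) (A : Set X) : MvPowerSeries (Fin 2) ℤ :=
  fun e => (((A ∩ ω ⁻¹' {e}).ncard : ℕ) : ℤ)

lemma coeff_gf {X : Type*} (ω : X → (Fin 2 →₀ ℕ)) (A : Set X) (e : Fin 2 →₀ ℕ) :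
    MvPowerSeries.coeff e (gf ω A) = (((A ∩ ω ⁻¹' {e}).ncard : ℕ) : ℤ) := rfl

/-- rational series -/
def Rat' (F : MvPowerSeries (Fin 2) ℤ) : Prop :=
  ∃ P Q : MvPolynomial (Fin 2) ℤ, MvPolynomial.coeff 0 Q = 1 ∧
    (Q : MvPowerSeries (Fin 2) ℤ) * F = (P : MvPowerSeries (Fin 2) ℤ)

lemma coeff_zero_mul' {P Q : MvPolynomial (Fin 2) ℤ} (hP : MvPolynomial.coeff 0 P = 1)
    (hQ : MvPolynomial.coeff 0 Q = 1) : MvPolynomial.coeff 0 (P * Q) = 1 := by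
  rw [← MvPolynomial.constantCoeff_eq] at *
  rw [map_mul, hP, hQ, one_mul]

lemma Rat'.add {F G : MvPowerSeries (Fin 2) ℤ} (hF : Rat' F) (hG : Rat' G) : Rat' (F + G) := by
  obtain ⟨P, Q, h, e⟩ := hF
  obtain ⟨P', Q', h', e'⟩ := hG
  refine ⟨Q' * P + Q * P', Q * Q', coeff_zero_mul' h h', ?_⟩
  push_cast
  rw [← e, ← e']; ring

lemma Rat'.sub {F G : MvPowerSeries (Fin 2) ℤ} (hF : Rat' F) (hG : Rat' G) : Rat' (F - G) := by
  obtain ⟨P, Q, h, e⟩ := hF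
  obtain ⟨P', Q', h', e'⟩ := hG
  refine ⟨Q' * P + Q * (-1 * P'), Q * Q', coeff_zero_mul' h h', ?_⟩
  have : ((-1 : MvPolynomial (Fin 2) ℤ) : MvPowerSeries (Fin 2) ℤ) = -1 := by
    rw [← MvPolynomial.coeToMvPowerSeries.ringHom_apply, map_neg, map_one]
  push_cast
  rw [← e, ← e', this]; ring

lemma Rat'.monomial_mul {F : MvPowerSeries (Fin 2) ℤ} (hF : Rat' F) (c : Fin 2 →₀ ℕ) :
    Rat' (monomial c 1 * F) := by
  obtain ⟨P, Q, h, e⟩ := hF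
  refine ⟨MvPolynomial.monomial c 1 * P, Q, h, ?_⟩
  push_cast
  rw [← e]; ring

lemma Rat'.div {F : MvPowerSeries (Fin 2) ℤ} (c : Fin 2 →₀ ℕ) (hc : c ≠ 0)
    (hF : Rat' (F - monomial c 1 * F)) : Rat' F := by
  obtain ⟨P, Q, h, e⟩ := hF
  refine ⟨P, Q * (1 + (-1) * MvPolynomial.monomial c 1), coeff_zero_mul' h ?_, ?_⟩
  · simp [MvPolynomial.coeff_monomial, hc]
  have : ((-1 : MvPolynomial (Fin 2) ℤ) : MvPowerSeries (Fin 2) ℤ) = -1 := by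
    rw [← MvPolynomial.coeToMvPowerSeries.ringHom_apply, map_neg, map_one]
  push_cast
  rw [← e, this]; ring

lemma rat_zero : Rat' 0 := ⟨0, 1, by simp, by simp⟩

lemma rat_one : Rat' 1 := ⟨1, 1, by simp, by simp⟩

lemma gf_empty {X : Type*} (ω : X → (Fin 2 →₀ ℕ)) : gf ω ∅ = 0 := by
  ext e; rw [coeff_gf]; simp

lemma gf_union_inter {X : Type*} {ω : X → (Fin 2 →₀ ℕ)} (hfin : ∀ e, (ω ⁻¹' {e}).Finite)
    (A B : Set X) : gf ω (A ∪ B) + gf ω (A ∩ B) = gf ω A + gf ω B := by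
  ext e
  rw [map_add, map_add, coeff_gf, coeff_gf, coeff_gf, coeff_gf, Set.union_inter_distrib_right,
    Set.inter_inter_distrib_right]
  exact_mod_cast Set.ncard_union_add_ncard_inter _ _ ((hfin e).inter_of_right _)
    ((hfin e).inter_of_right _)

lemma gf_union {X : Type*} {ω : X → (Fin 2 →₀ ℕ)} (hfin : ∀ e, (ω ⁻¹' {e}).Finite)
    {A B : Set X} (h : A ∩ B = ∅) : gf ω (A ∪ B) = gf ω A + gf ω B := by
  rw [← gf_union_inter hfin, h, gf_empty, add_zero]

lemma gf_image {X Y : Type*} (ω : X → (Fin 2 →₀ ℕ)) (ω' : Y → (Fin 2 →₀ ℕ)) (f : X → Y)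
    (c : Fin 2 →₀ ℕ) (A : Set X) (hf : Set.InjOn f A) (h : ∀ x ∈ A, ω' (f x) = c + ω x) :
    gf ω' (f '' A) = monomial c 1 * gf ω A := by
  ext e
  rw [coeff_monomial_mul, coeff_gf]
  split_ifs with hc
  · rw [coeff_gf, one_mul]
    have : f '' A ∩ ω' ⁻¹' {e} = f '' (A ∩ ω ⁻¹' {e - c}) := by
      ext y
      constructor
      · rintro ⟨⟨x, hx, rfl⟩, hy⟩
        refine ⟨x, ⟨hx, ?_⟩, rfl⟩
        simp only [Set.mem_preimage, Set.mem_singleton_iff] at hy ⊢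
        rw [← hy, h x hx]; simp
      · rintro ⟨x, ⟨hx, hy⟩, rfl⟩
        refine ⟨⟨x, hx, rfl⟩, ?_⟩
        simp only [Set.mem_preimage, Set.mem_singleton_iff] at hy ⊢
        rw [h x hx, hy]; exact add_tsub_cancel_of_le hc
    rw [this, Set.InjOn.ncard_image (hf.mono Set.inter_subset_left)]
  · have : f '' A ∩ ω' ⁻¹' {e} = ∅ := by
      rw [Set.eq_empty_iff_forall_notMem]
      rintro y ⟨⟨x, hx, rfl⟩, hy⟩
      simp only [Set.mem_preimage, Set.mem_singleton_iff] at hy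
      apply hc
      rw [← hy, h x hx]; exact le_self_add
    rw [this]; simp

lemma gf_bij {X Y : Type*} (ω : X → (Fin 2 →₀ ℕ)) (ω' : Y → (Fin 2 →₀ ℕ)) (f : X → Y)
    (A : Set X) (hf : Set.InjOn f A) (h : ∀ x ∈ A, ω' (f x) = ω x) :
    gf ω' (f '' A) = gf ω A := by
  rw [gf_image ω ω' f 0 A hf (by simpa using h), monomial_zero_one, one_mul]

section upper
variable {m : ℕ}

lemma rat_cone (ω : (Fin m → ℕ) →+ (Fin 2 →₀ ℕ)) (hfin : ∀ e, (ω ⁻¹' {e}).Finite)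
    (hω : ∀ i, ω (Pi.single i 1) ≠ 0) (s : Finset (Fin m)) : Rat' (gf ω {u | ∀ i, i ∉ s → u i = 0}) := by
  induction s using Finset.induction_on with
  | empty =>
    have : {u : Fin m → ℕ | ∀ i, i ∉ (∅ : Finset (Fin m)) → u i = 0}
        = (fun _ : Unit => (0 : Fin m → ℕ)) '' Set.univ := by
      ext u
      simp [funext_iff]
    rw [this, gf_image (fun _ => 0) ω _ 0 _ (by intro a _ b _ _; rfl) (by simp)]
    apply Rat'.monomial_mul
    have : gf (fun _ : Unit => (0 : Fin 2 →₀ ℕ)) Set.univ = 1 := by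
      ext e
      rw [coeff_gf, coeff_one]
      by_cases h : e = 0
      · subst h; simp [Set.preimage]
      · simp [h, Set.preimage, Ne.symm h]
    rw [this]; exact rat_one
  | insert j s hj ih =>
    apply Rat'.div (ω (Pi.single j 1)) (hω j)
    rw [← gf_image ω ω (fun u => Pi.single j 1 + u) (ω (Pi.single j 1)) _
      (fun a _ b _ h => by simpa using h) (fun u _ => by simp)]
    convert ih using 1
    rw [sub_eq_iff_eq_add, ← gf_union hfin]
    · congr 1
      ext u
      constructor
      · intro hu
        by_cases h0 : u j = 0
        · left
          intro i hi
          by_cases hij : i = j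
          · rw [hij]; exact h0
          · exact hu i (by simp [hij, hi])
        · right
          refine ⟨u - Pi.single j 1, ?_, ?_⟩
          · intro i hi
            simp [hu i hi]
          · funext i
            by_cases hij : i = j
            · subst hij; simp; omega
            · simp [hij]
      · rintro (hu | ⟨v, hv, rfl⟩) i hi
        · exact hu i (fun h => hi (by simp [h]))
        · have hij : i ≠ j := fun h => hi (by simp [h])
          simp [hij, hv i hi]
    · rw [Set.eq_empty_iff_forall_notMem]
      rintro u ⟨hu, ⟨v, hv, rfl⟩⟩
      have := hu j hj
      simp at this

lemma rat_univ (ω : (Fin m → ℕ) →+ (Fin 2 →₀ ℕ)) (hfin : ∀ e, (ω ⁻¹' {e}).Finite)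
    (hω : ∀ i, ω (Pi.single i 1) ≠ 0) : Rat' (gf ω Set.univ) := by
  have := rat_cone ω hfin hω Finset.univ
  simpa using this

lemma rat_Ici (ω : (Fin m → ℕ) →+ (Fin 2 →₀ ℕ)) (hfin : ∀ e, (ω ⁻¹' {e}).Finite)
    (hω : ∀ i, ω (Pi.single i 1) ≠ 0) (f : Fin m → ℕ) : Rat' (gf ω (Set.Ici f)) := by
  have : Set.Ici f = (fun u => f + u) '' Set.univ := by
    ext u
    simp only [Set.mem_Ici, Set.image_univ, Set.mem_range]
    rw [le_iff_exists_add]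
    simp [eq_comm]
  rw [this, gf_image ω ω _ (ω f) _ (fun a _ b _ h => by simpa using h) (fun u _ => by simp)]
  exact (rat_univ ω hfin hω).monomial_mul _

lemma rat_up (ω : (Fin m → ℕ) →+ (Fin 2 →₀ ℕ)) (hfin : ∀ e, (ω ⁻¹' {e}).Finite)
    (hω : ∀ i, ω (Pi.single i 1) ≠ 0) (n : ℕ) : ∀ F : Finset (Fin m → ℕ), F.card ≤ n →
    Rat' (gf ω {u | ∃ f ∈ F, f ≤ u}) := by
  induction n with
  | zero =>
    intro F hF
    have : F = ∅ := by simpa using hF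
    subst this
    simpa [gf_empty] using rat_zero
  | succ n ih =>
    intro F hF
    rcases F.eq_empty_or_nonempty with rfl | ⟨f, hf⟩
    · simpa [gf_empty] using rat_zero
    have hc : (F.erase f).card ≤ n := by rw [Finset.card_erase_of_mem hf]; omega
    have h1 := ih (F.erase f) hc
    have h2 := ih ((F.erase f).image (f ⊔ ·)) (Finset.card_image_le.trans hc)
    have e1 : {u | ∃ g ∈ F, g ≤ u} = {u | ∃ g ∈ F.erase f, g ≤ u} ∪ Set.Ici f := by
      ext u
      constructor
      · rintro ⟨g, hg, hu⟩
        by_cases h : g = f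
        · right; rw [← h]; exact hu
        · left; exact ⟨g, Finset.mem_erase.2 ⟨h, hg⟩, hu⟩
      · rintro (⟨g, hg, hu⟩ | hu)
        · exact ⟨g, Finset.mem_of_mem_erase hg, hu⟩
        · exact ⟨f, hf, hu⟩
    have e2 : {u | ∃ g ∈ (F.erase f).image (f ⊔ ·), g ≤ u}
        = {u | ∃ g ∈ F.erase f, g ≤ u} ∩ Set.Ici f := by
      ext u
      constructor
      · rintro ⟨g, hg, hu⟩
        obtain ⟨g', hg', rfl⟩ := Finset.mem_image.1 hg
        exact ⟨⟨g', hg', le_sup_right.trans hu⟩, le_sup_left.trans hu⟩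
      · rintro ⟨⟨g, hg, hu⟩, hf'⟩
        exact ⟨f ⊔ g, Finset.mem_image_of_mem _ hg, sup_le hf' hu⟩
    have := gf_union_inter hfin {u | ∃ g ∈ F.erase f, g ≤ u} (Set.Ici f)
    rw [e1, eq_sub_of_add_eq this]
    rw [e2] at h2
    exact (h1.add (rat_Ici ω hfin hω f)).sub h2

lemma rat_upper (ω : (Fin m → ℕ) →+ (Fin 2 →₀ ℕ)) (hfin : ∀ e, (ω ⁻¹' {e}).Finite)
    (hω : ∀ i, ω (Pi.single i 1) ≠ 0) (I : Set (Fin m → ℕ)) (hI : IsUpperSet I) : Rat' (gf ω I) := by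
  have hF : {u | Minimal (· ∈ I) u}.Finite :=
    WellQuasiOrderedLE.finite_of_isAntichain (setOfPred_minimal_antichain _)
  have : I = {u | ∃ f ∈ hF.toFinset, f ≤ u} := by
    ext u
    constructor
    · intro hu
      obtain ⟨f, hf, hm⟩ := exists_minimal_le_of_wellFoundedLT (· ∈ I) u hu
      exact ⟨f, by simpa using hm, hf⟩
    · rintro ⟨f, hf, hu⟩
      have hm : Minimal (· ∈ I) f := by simpa using hf
      exact hI hu hm.prop
  rw [this]
  exact rat_up ω hfin hω _ _ le_rfl

end upper

/-- grading on exponents -/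
noncomputable def mkW (a b : ℕ) : Fin 2 →₀ ℕ := Finsupp.single 0 a + Finsupp.single 1 b

lemma mkW_eq_iff (a b : ℕ) (e : Fin 2 →₀ ℕ) : mkW a b = e ↔ a = e 0 ∧ b = e 1 := by
  rw [Finsupp.ext_iff, Fin.forall_fin_two]
  simp [mkW]

noncomputable def grade (d : ℕ) : (Fin d → ℕ) →+ (Fin 2 →₀ ℕ) where
  toFun a := mkW (∑ j, a j) (∑ j : Fin d, j.val * a j)
  map_zero' := by simp [mkW]
  map_add' a b := by
    simp only [mkW, Pi.add_apply, mul_add, Finset.sum_add_distrib, Finsupp.single_add]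
    abel

lemma rat_range {d m : ℕ} (φ : (Fin m → ℕ) →+ (Fin d → ℕ)) (hφ : ∀ i, φ (Pi.single i 1) ≠ 0) :
    Rat' (gf (grade d) (Set.range φ)) := by
  set ω : (Fin m → ℕ) →+ (Fin 2 →₀ ℕ) := (grade d).comp φ with hωd
  have h0 : ∀ u, (ω u) 0 = ∑ j, φ u j := by
    intro u
    exact ((mkW_eq_iff _ _ (ω u)).1 rfl).1.symm
  have hpos : ∀ i, 1 ≤ (ω (Pi.single i 1)) 0 := by
    intro i
    rw [h0]
    obtain ⟨j, hj⟩ := Function.ne_iff.1 (hφ i)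
    calc 1 ≤ φ (Pi.single i 1) j := Nat.one_le_iff_ne_zero.2 hj
      _ ≤ _ := Finset.single_le_sum (f := fun j => φ (Pi.single i 1) j)
        (fun _ _ => Nat.zero_le _) (Finset.mem_univ j)
  have hω : ∀ i, ω (Pi.single i 1) ≠ 0 := by
    intro i h
    have := hpos i
    rw [h] at this
    simp at this
  have hle : ∀ u i, u i ≤ (ω u) 0 := by
    intro u i
    have hu : u = u i • Pi.single i 1 + (u - Pi.single i (u i)) := by
      funext k
      by_cases hk : k = i
      · subst hk; simp
      · simp [hk]
    have : ω u = u i • ω (Pi.single i 1) + ω (u - Pi.single i (u i)) := by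
      conv_lhs => rw [hu]
      rw [map_add, map_nsmul]
    rw [this]
    simp only [Finsupp.coe_add, Finsupp.coe_smul, Pi.add_apply, Pi.smul_apply, smul_eq_mul]
    have := Nat.mul_le_mul_left (u i) (hpos i)
    omega
  have hfin : ∀ e, (ω ⁻¹' {e}).Finite := by
    intro e
    refine (Set.finite_Iic (fun _ : Fin m => e 0)).subset ?_
    intro u hu i
    have hu' : ω u = e := hu
    rw [← hu']; exact hle u i
  set I : Set (Fin m → ℕ) := {u | ∃ v, φ v = φ u ∧ toLex v < toLex u} with hI
  have hup : IsUpperSet I := by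
    rintro u w huw ⟨v, hv, hlt⟩
    obtain ⟨c, rfl⟩ := exists_add_of_le huw
    refine ⟨v + c, by rw [map_add, map_add, hv], ?_⟩
    rw [toLex_add, toLex_add]
    exact add_lt_add_left hlt _
  have himg : Set.range φ = φ '' Iᶜ := by
    ext a
    constructor
    · rintro ⟨u, rfl⟩
      have hf : (φ ⁻¹' {φ u}).Finite := by
        refine (hfin (ω u)).subset ?_
        intro v hv
        have hv' : φ v = φ u := hv
        simp [hωd, hv']
      obtain ⟨v, hv, hmin⟩ := Set.exists_min_image _ (fun w => toLex w) hf ⟨u, rfl⟩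
      refine ⟨v, ?_, hv⟩
      rintro ⟨w, hw, hlt⟩
      have hv' : φ v = φ u := hv
      exact absurd (hmin w (by simp [hw, hv'])) (not_le.2 hlt)
    · rintro ⟨u, -, rfl⟩; exact ⟨u, rfl⟩
  have hinj : Set.InjOn φ Iᶜ := by
    intro u hu v hv h
    rcases lt_trichotomy (toLex u) (toLex v) with hl | hl | hl
    · exact absurd ⟨u, h, hl⟩ hv
    · exact toLex.injective hl
    · exact absurd ⟨v, h.symm, hl⟩ hu
  rw [himg, gf_bij ω (grade d) φ _ hinj (fun _ _ => rfl)]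
  have h1 := gf_union (ω := ω) hfin (A := I) (B := Iᶜ) (by simp)
  rw [Set.union_compl_self] at h1
  rw [← sub_eq_of_eq_add' h1]
  exact (rat_univ ω hfin hω).sub (rat_upper ω hfin hω I hup)

lemma grade_fin (d : ℕ) (e : Fin 2 →₀ ℕ) : ((grade d) ⁻¹' {e}).Finite := by
  refine (Set.finite_Iic (fun _ : Fin d => e 0)).subset ?_
  intro u hu i
  have hu' : grade d u = e := hu
  rw [← ((mkW_eq_iff _ _ e).1 hu').1]
  exact Finset.single_le_sum (f := fun j => u j) (fun _ _ => Nat.zero_le _) (Finset.mem_univ i)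

lemma rat_semigroup {d : ℕ} (T : Finset (Fin d → ℕ)) :
    Rat' (gf (grade d) (AddSubsemigroup.closure (T : Set (Fin d → ℕ)) : Set (Fin d → ℕ))) := by
  classical
  set Γ := AddSubsemigroup.closure (T : Set (Fin d → ℕ)) with hΓ
  let M : AddSubmonoid (Fin d → ℕ) :=
    { carrier := {a | a = 0 ∨ a ∈ Γ}
      zero_mem' := Or.inl rfl
      add_mem' := by
        rintro a b (rfl | ha) (rfl | hb)
        · left; simp
        · right; simpa using hb
        · right; simpa using ha
        · right; exact Γ.add_mem ha hb }
  let t : Fin (T.erase 0).card → (Fin d → ℕ) := fun i => ((T.erase 0).equivFin.symm i).1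
  let φ : (Fin (T.erase 0).card → ℕ) →+ (Fin d → ℕ) :=
    { toFun := fun u => ∑ i, u i • t i
      map_zero' := by simp
      map_add' := fun u v => by simp [add_smul, Finset.sum_add_distrib] }
  have hs : ∀ i, φ (Pi.single i 1) = t i := by
    intro i
    change ∑ k, (Pi.single i 1 : _ → ℕ) k • t k = t i
    rw [Finset.sum_eq_single i]
    · simp
    · intro k _ hk; simp [hk]
    · simp
  have ht : ∀ i, t i ∈ T.erase 0 := fun i => ((T.erase 0).equivFin.symm i).2
  have hr : Set.range φ = {a | a = 0 ∨ a ∈ Γ} := by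
    ext a
    constructor
    · rintro ⟨u, rfl⟩
      change (∑ i, u i • t i) ∈ M
      refine AddSubmonoid.sum_mem M fun i _ => AddSubmonoid.nsmul_mem M ?_ _
      exact Or.inr (AddSubsemigroup.subset_closure (Finset.mem_of_mem_erase (ht i)))
    · rintro (rfl | ha)
      · exact ⟨0, map_zero _⟩
      · induction ha using AddSubsemigroup.closure_induction with
        | mem x hx =>
          by_cases h : x = 0
          · exact ⟨0, by rw [map_zero, h]⟩
          · have hx' : x ∈ T.erase 0 := Finset.mem_erase.2 ⟨h, hx⟩
            refine ⟨Pi.single ((T.erase 0).equivFin ⟨x, hx'⟩) 1, ?_⟩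
            rw [hs]; simp [t]
        | add x y _ _ hx hy =>
          obtain ⟨u, rfl⟩ := hx
          obtain ⟨v, rfl⟩ := hy
          exact ⟨u + v, map_add _ _ _⟩
  have hR := rat_range φ (fun i => by rw [hs]; exact (Finset.mem_erase.1 (ht i)).1)
  rw [hr] at hR
  by_cases h0 : (0 : Fin d → ℕ) ∈ Γ
  · have : {a | a = 0 ∨ a ∈ Γ} = (Γ : Set (Fin d → ℕ)) := by
      ext a; constructor
      · rintro (rfl | h); exact h0; exact h
      · exact Or.inr
    rwa [this] at hR
  · have h1 : {a | a = 0 ∨ a ∈ Γ} = {0} ∪ (Γ : Set (Fin d → ℕ)) := by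
      ext a; rfl
    have h2 := gf_union (ω := grade d) (grade_fin d) (A := {0}) (B := (Γ : Set (Fin d → ℕ)))
      (by simpa using h0)
    rw [← sub_eq_of_eq_add' h2, ← h1]
    refine hR.sub ?_
    have h3 : ({0} : Set (Fin d → ℕ)) = Set.range (0 : (Fin 0 → ℕ) →+ (Fin d → ℕ)) := by
      ext a; simp [eq_comm]
    rw [h3]
    exact rat_range _ (fun i => i.elim0)

end series
end Spiral
open Spiral in
/-- Let `x₀ ∈ ℕ^d` and let `Γ′` be a finitely generated subsemigroup of
`(ℕ^d, +)`. Then the power series `f = Σ_{x ∈ Γ′·x₀} t^{n(x)} q^{W(x)} ∈ ℤ[[t,q]]` is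
rational: there are polynomials `P, Q ∈ ℤ[t,q]` with `Q(0,0) = 1` and `Q·f = P`. -/
theorem statement12 (d : ℕ) (hd : 1 ≤ d) (x₀ : Fin d → ℕ)
    (Γ' : AddSubsemigroup (Fin d → ℕ))
    (hfg : ∃ T : Finset (Fin d → ℕ), Γ' = AddSubsemigroup.closure (T : Set (Fin d → ℕ))) :
    ∃ P Q : MvPolynomial (Fin 2) ℤ, MvPolynomial.coeff 0 Q = 1 ∧
      (Q : MvPowerSeries (Fin 2) ℤ) *
        orbitSeries d {x | ∃ a ∈ Γ', gIter d a x₀ = x} =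
      (P : MvPowerSeries (Fin 2) ℤ) := by
  obtain ⟨T, rfl⟩ := hfg
  set Γ := AddSubsemigroup.closure (T : Set (Fin d → ℕ)) with hΓ
  have h1 := (rat_semigroup T).monomial_mul (mkW (size x₀) (weight x₀))
  rw [← hΓ, ← gf_image (grade d) (fun x : Fin d → ℕ => mkW (size x) (weight x))
    (fun a => gIter d a x₀) _ _ (gIter_inj hd x₀).injOn (fun a _ => by
      simp only [gIter_size hd, gIter_weight hd]
      change _ = _ + mkW _ _
      simp only [mkW, Finsupp.single_add]
      abel)] at h1
  have h2 : orbitSeries d {x | ∃ a ∈ Γ, gIter d a x₀ = x} =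
      gf (fun x : Fin d → ℕ => mkW (size x) (weight x)) ((fun a => gIter d a x₀) '' (Γ : Set _)) := by
    funext e
    simp only [orbitSeries, gf]
    rw [← Nat.card_coe_set_eq]
    congr 1
    apply Nat.card_congr
    apply Equiv.subtypeEquivRight
    intro x
    simp only [Set.mem_inter_iff, Set.mem_preimage, Set.mem_singleton_iff, mkW_eq_iff]
    rfl
  rw [h2]
  exact h1
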